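/- arXiv:1801.07608 — 2 statements merged into one kernel-verified Lean document; each statement's English description precedes it below -/
import Mathlib

section
/- Let f : ℝ → ℝ be 1-periodic, bounded, and such that its set of discontinuity points has Lebesgue measure zero. Let (q_i)_{i∈ℕ} be a sequence of positive integers with q_i → ∞ and let (y_i)_{i∈ℕ} be any sequence of reals. Then lim_{i→∞} sup_{l∈ℤ} | (1/q_i)·Σ_{m=0}^{q_i−1} f(y_i + m/q_i)·f(y_i + (m−l)/q_i) − ∫₀¹ f(x)·f(x − l/q_i) dx | = 0. -/
open MeasureTheory Filter

/-- The largest point of the grid `y + (1 / q) ℤ` not exceeding `x`. -/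
noncomputable def gridFloor (q : ℕ) (y x : ℝ) : ℝ := y + ⌊(x - y) * q⌋ / q

theorem gridFloor_sub_int_div {q : ℕ} (hq : 0 < q) (y x : ℝ) (l : ℤ) :
    gridFloor q y (x - l / q) = gridFloor q y x - l / q := by
  have hq' : (q : ℝ) ≠ 0 := by positivity
  have h : (x - l / q - y) * q = (x - y) * q - l := by field_simp; ring
  rw [gridFloor, gridFloor, h, Int.floor_sub_intCast, Int.cast_sub]
  ring

theorem gridFloor_add_one {q : ℕ} (hq : 0 < q) (y x : ℝ) :
    gridFloor q y (x + 1) = gridFloor q y x + 1 := by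
  have hq' : (q : ℝ) ≠ 0 := by positivity
  have h := gridFloor_sub_int_div hq y x (-q)
  have h' : (((-q : ℤ) : ℝ)) / q = -1 := by push_cast; field_simp
  rwa [h', sub_neg_eq_add, sub_neg_eq_add] at h

theorem abs_gridFloor_sub_le {q : ℕ} (hq : 0 < q) (y x : ℝ) :
    |gridFloor q y x - x| ≤ 1 / q := by
  have hq' : (0 : ℝ) < q := by positivity
  have h : gridFloor q y x - x = -(Int.fract ((x - y) * q) / q) := by
    rw [gridFloor, ← Int.self_sub_floor]
    field_simp
    ring
  rw [h, abs_neg, abs_of_nonneg (div_nonneg (Int.fract_nonneg _) hq'.le)]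
  exact div_le_div_of_nonneg_right (Int.fract_lt_one _).le hq'.le

theorem measurable_comp_gridFloor (f : ℝ → ℝ) (q : ℕ) (y : ℝ) :
    Measurable fun x => f (gridFloor q y x) := by
  have h : Measurable fun n : ℤ => f (y + n / q) := measurable_of_countable _
  exact h.comp (Int.measurable_floor.comp (by fun_prop))

theorem tendsto_gridFloor {q : ℕ → ℕ} (hq : ∀ i, 0 < q i) (hqlim : Tendsto q atTop atTop)
    (y : ℕ → ℝ) (x : ℝ) : Tendsto (fun i => gridFloor (q i) (y i) x) atTop (nhds x) := by
  rw [tendsto_iff_dist_tendsto_zero]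
  refine squeeze_zero (fun _ => dist_nonneg) (fun i => abs_gridFloor_sub_le (hq i) (y i) x) ?_
  exact tendsto_one_div_atTop_nhds_zero_nat.comp hqlim

theorem integral_comp_gridFloor {q : ℕ} (hq : 0 < q) (g : ℝ → ℝ) (y : ℝ) :
    ∫ x in y..y + 1, g (gridFloor q y x) =
      (1 / (q : ℝ)) * ∑ m ∈ Finset.range q, g (y + m / q) := by
  have hq' : (0 : ℝ) < q := by positivity
  have hle (m : ℕ) : y + (m : ℝ) / q ≤ y + ((m + 1 : ℕ) : ℝ) / q := by
    gcongr
    simp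
  have heq (m : ℕ) : Set.EqOn (fun _ => g (y + m / q)) (fun x => g (gridFloor q y x))
      (Set.Ioo (y + (m : ℝ) / q) (y + ((m + 1 : ℕ) : ℝ) / q)) := by
    intro x hx
    have hfloor : ⌊(x - y) * q⌋ = (m : ℤ) := by
      rw [Int.floor_eq_iff]
      have h₁ := hx.1
      have h₂ := hx.2
      rw [← lt_sub_iff_add_lt', div_lt_iff₀ hq'] at h₁
      rw [← sub_lt_iff_lt_add', lt_div_iff₀ hq'] at h₂
      push_cast at h₂ ⊢
      exact ⟨h₁.le, h₂⟩
    simp [gridFloor, hfloor]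
  have hsum := intervalIntegral.sum_integral_adjacent_intervals (μ := volume)
    (f := fun x => g (gridFloor q y x)) (a := fun m : ℕ => y + (m : ℝ) / q) (n := q)
    fun m _ => (intervalIntegrable_const (c := g (y + m / q))).congr_uIoo
      (by rw [Set.uIoo_of_le (hle m)]; exact heq m)
  have hend : y + (q : ℝ) / q = y + 1 := by rw [div_self hq'.ne']
  simp only [Nat.cast_zero, zero_div, add_zero, hend] at hsum
  rw [← hsum, Finset.mul_sum]
  refine Finset.sum_congr rfl fun m _ => ?_
  rw [← intervalIntegral.integral_congr_Ioo_of_le (hle m) (heq m),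
    intervalIntegral.integral_const, smul_eq_mul]
  push_cast
  ring

/-- An almost everywhere continuous function is almost everywhere strongly measurable. -/
theorem aestronglyMeasurable_of_volume_discontinuities {f : ℝ → ℝ}
    (hdisc : volume {x : ℝ | ¬ ContinuousAt f x} = 0) : AEStronglyMeasurable f volume := by
  have hae : ∀ᵐ x, ContinuousAt f x := ae_iff.2 hdisc
  have hq (i : ℕ) : 0 < i + 1 := i.succ_pos
  refine aestronglyMeasurable_of_tendsto_ae atTop
    (f := fun i x => f (gridFloor (i + 1) 0 x))
    (fun i => (measurable_comp_gridFloor f _ _).aestronglyMeasurable) ?_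
  filter_upwards [hae] with x hx
  exact hx.tendsto.comp (tendsto_gridFloor hq (tendsto_add_atTop_nat 1) (fun _ => 0) x)

theorem intervalIntegrable_of_abs_le {g : ℝ → ℝ} {C : ℝ} (hg : AEStronglyMeasurable g volume)
    (hC : ∀ x, |g x| ≤ C) (a b : ℝ) : IntervalIntegrable g volume a b :=
  (intervalIntegrable_const (c := C)).mono_fun' hg.restrict (Eventually.of_forall hC)

theorem tendsto_integral_abs_comp_gridFloor_sub {f : ℝ → ℝ} {C : ℝ} (hC : ∀ x, |f x| ≤ C)
    (hdisc : volume {x : ℝ | ¬ ContinuousAt f x} = 0)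
    {q : ℕ → ℕ} (hq : ∀ i, 0 < q i) (hqlim : Tendsto q atTop atTop) (y : ℕ → ℝ) :
    Tendsto (fun i => ∫ x in (0 : ℝ)..1, |f (gridFloor (q i) (y i) x) - f x|) atTop (nhds 0) := by
  have hae : ∀ᵐ x, ContinuousAt f x := ae_iff.2 hdisc
  have hf := aestronglyMeasurable_of_volume_discontinuities hdisc
  have h : Tendsto (fun i => ∫ x in (0 : ℝ)..1, |f (gridFloor (q i) (y i) x) - f x|) atTop
      (nhds (∫ _ in (0 : ℝ)..1, (0 : ℝ))) := by
    refine intervalIntegral.tendsto_integral_filter_of_dominated_convergence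
      (fun _ => C + C) (Eventually.of_forall fun i => ?_) (Eventually.of_forall fun i => ?_)
      intervalIntegrable_const ?_
    · exact ((measurable_comp_gridFloor f _ _).aestronglyMeasurable.sub hf).norm.restrict
    · refine Eventually.of_forall fun x _ => ?_
      rw [Real.norm_eq_abs, abs_abs]
      exact (abs_sub _ _).trans (add_le_add (hC _) (hC _))
    · filter_upwards [hae] with x hx _
      have := (hx.tendsto.comp (tendsto_gridFloor hq hqlim y x)).sub_const (f x)
      simpa using this.abs
  simpa using h

/-- The discrete correlation differs from the continuous one by at most `2 C` times the `L¹`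
distance between `f` and its sampling along the grid, independently of the shift. -/
theorem abs_discrete_correlation_sub_le {f : ℝ → ℝ} (hper : Function.Periodic f 1) {C : ℝ}
    (hC : ∀ x, |f x| ≤ C) (hf : AEStronglyMeasurable f volume) {q : ℕ} (hq : 0 < q) (y : ℝ)
    (l : ℤ) :
    |(1 / (q : ℝ)) * ∑ m ∈ Finset.range q, f (y + (m : ℝ) / q) * f (y + ((m : ℝ) - l) / q)
        - ∫ x in (0 : ℝ)..1, f x * f (x - l / q)|
      ≤ 2 * C * ∫ x in (0 : ℝ)..1, |f (gridFloor q y x) - f x| := by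
  have hC0 : 0 ≤ C := (abs_nonneg _).trans (hC 0)
  set s := gridFloor q y with hs
  set t : ℝ := l / q with ht
  set d : ℝ → ℝ := fun x => |f (s x) - f x| with hd
  have hfs : AEStronglyMeasurable (fun x => f (s x)) volume :=
    (measurable_comp_gridFloor f q y).aestronglyMeasurable
  have hshift {g : ℝ → ℝ} (hg : AEStronglyMeasurable g volume) :
      AEStronglyMeasurable (fun x => g (x - t)) volume :=
    hg.comp_measurePreserving (measurePreserving_sub_right volume t)
  have hst (x : ℝ) : s (x - t) = s x - t := gridFloor_sub_int_div hq y x l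
  have hsper (x : ℝ) : s (x + 1) = s x + 1 := gridFloor_add_one hq y x
  have hmul (a b : ℝ) : |f a * f b| ≤ C * C := by
    rw [abs_mul]
    exact mul_le_mul (hC _) (hC _) (abs_nonneg _) hC0
  have hdm : AEStronglyMeasurable d volume := (hfs.sub hf).norm
  have hdC (x : ℝ) : |d x| ≤ C + C := by
    rw [hd, abs_abs]
    exact (abs_sub _ _).trans (add_le_add (hC _) (hC _))
  have hdper : Function.Periodic d 1 := fun x => by simp only [hd, hsper, hper _]
  have hsper' : Function.Periodic (fun x => f (s x) * f (s x - t)) 1 := fun x => by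
    have : s x + 1 - t = s x - t + 1 := by ring
    simp only [hsper, this, hper _]
  have hdiscrete : (1 / (q : ℝ)) *
      ∑ m ∈ Finset.range q, f (y + (m : ℝ) / q) * f (y + ((m : ℝ) - l) / q)
      = ∫ x in (0 : ℝ)..1, f (s x) * f (s x - t) := by
    have h₁ := integral_comp_gridFloor hq (fun x => f x * f (x - t)) y
    have h₂ := hsper'.intervalIntegral_add_eq y 0
    rw [zero_add] at h₂
    rw [← h₂, h₁]
    refine congrArg _ (Finset.sum_congr rfl fun m _ => ?_)
    rw [ht, sub_div, add_sub_assoc]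
  have hint₁ : IntervalIntegrable (fun x => f (s x) * f (s x - t)) volume 0 1 := by
    refine intervalIntegrable_of_abs_le ?_ (fun x => hmul _ _) 0 1
    simp only [← hst]
    exact hfs.mul (hshift hfs)
  have hint₂ : IntervalIntegrable (fun x => f x * f (x - t)) volume 0 1 :=
    intervalIntegrable_of_abs_le (hf.mul (hshift hf)) (fun x => hmul _ _) 0 1
  have hint₃ : IntervalIntegrable d volume 0 1 := intervalIntegrable_of_abs_le hdm hdC 0 1
  have hint₄ : IntervalIntegrable (fun x => d (x - t)) volume 0 1 :=
    intervalIntegrable_of_abs_le (hshift hdm) (fun x => hdC _) 0 1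
  have hdshift : ∫ x in (0 : ℝ)..1, d (x - t) = ∫ x in (0 : ℝ)..1, d x := by
    have h := hdper.intervalIntegral_add_eq (0 - t) 0
    rw [intervalIntegral.integral_comp_sub_right, ← zero_add (1 : ℝ), ← h]
    congr 1
    ring
  have hpoint (x : ℝ) :
      |f (s x) * f (s x - t) - f x * f (x - t)| ≤ C * (d x + d (x - t)) := by
    have h : f (s x) * f (s x - t) - f x * f (x - t)
        = f (s x - t) * (f (s x) - f x) + f x * (f (s x - t) - f (x - t)) := by ring
    rw [h, mul_add]
    refine (abs_add_le _ _).trans ?_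
    rw [abs_mul, abs_mul]
    simp only [hd, hst]
    gcongr
    · exact hC _
    · exact hC _
  rw [hdiscrete, ← intervalIntegral.integral_sub hint₁ hint₂]
  calc _ ≤ ∫ x in (0 : ℝ)..1, |f (s x) * f (s x - t) - f x * f (x - t)| :=
        intervalIntegral.abs_integral_le_integral_abs zero_le_one
    _ ≤ ∫ x in (0 : ℝ)..1, C * (d x + d (x - t)) :=
        intervalIntegral.integral_mono_on zero_le_one (hint₁.sub hint₂).abs
          ((hint₃.add hint₄).const_mul C) fun x _ => hpoint x
    _ = 2 * C * ∫ x in (0 : ℝ)..1, d x := by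
        rw [intervalIntegral.integral_const_mul, intervalIntegral.integral_add hint₃ hint₄,
          hdshift]
        ring



/-- For a 1-periodic bounded Riemann-integrable `f` (discontinuity set Lebesgue null),
any sequence of denominators `q_i → ∞` and any reference points `y_i`, the discrete
correlation of `f` along the `q_i`-periodic orbit approximates the continuous
correlation uniformly in the shift `l ∈ ℤ`. -/
theorem discrete_correlation_uniform_approximation
    (f : ℝ → ℝ) (hper : Function.Periodic f 1)
    (hbdd : ∃ C : ℝ, ∀ x, |f x| ≤ C)
    (hdisc : volume {x : ℝ | ¬ ContinuousAt f x} = 0)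
    (q : ℕ → ℕ) (hq : ∀ i, 0 < q i) (hqlim : Tendsto q atTop atTop)
    (y : ℕ → ℝ) :
    ∀ ε > (0:ℝ), ∀ᶠ i in atTop, ∀ l : ℤ,
      |(1 / (q i : ℝ)) *
          ∑ m ∈ Finset.range (q i),
            f (y i + (m : ℝ) / (q i : ℝ)) * f (y i + ((m : ℝ) - (l : ℝ)) / (q i : ℝ))
        - ∫ x in (0:ℝ)..1, f x * f (x - (l : ℝ) / (q i : ℝ))| < ε := by
  obtain ⟨C, hC⟩ := hbdd
  intro ε hε
  have h := (tendsto_integral_abs_comp_gridFloor_sub hC hdisc hq hqlim y).const_mul (2 * C)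
  rw [mul_zero] at h
  filter_upwards [h.eventually_lt_const hε] with i hi l
  exact (abs_discrete_correlation_sub_le hper hC
    (aestronglyMeasurable_of_volume_discontinuities hdisc) (hq i) (y i) l).trans_lt hi
end

section
/- Let f : ℝ → ℝ be 1-periodic, bounded, nonnegative, and such that its set of discontinuity points has Lebesgue measure zero. Let α > 0, let (α_i)_{i∈ℕ} be a sequence of positive reals with α_i ≠ α for all i and lim_{i→∞} α_i = α, and let (y_i)_{i∈ℕ} be any sequence of reals. For each i define Ξ_i : ℤ → ℝ by: Ξ_i(z) = (1/q_i)·Σ_{k=0}^{q_i−1} f(y_i + kα_i)·f(y_i + (k−z)α_i) if α_i = p_i/q_i is rational with p_i, q_i positive coprime integers, and Ξ_i(z) = ∫₀¹ f(x)·f(x − zα_i) dx if α_i is irrational. Then for every z ∈ ℤ, lim_{i→∞} Ξ_i(z) = ∫₀¹ f(x)·f(x − zα) dx. -/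
open MeasureTheory Filter

theorem Function.Periodic.sum_range_mul_add {q p : ℕ} (hq : 0 < q) (hpq : p.Coprime q)
    {g : ℤ → ℝ} (hg : Function.Periodic g q) (m : ℤ) :
    ∑ k ∈ Finset.range q, g (k * p + m) = ∑ k ∈ Finset.range q, g k := by
  have : NeZero q := ⟨hq.ne'⟩
  let G : ZMod q → ℝ := fun a => g a.val
  have hG (n : ℤ) : g n = G n := by
    simp only [G, ZMod.val_intCast]
    have h := hg.int_mul (n / q) (n % q)
    rw [← h]
    congr 1
    have := Int.emod_add_mul_ediv n q
    simp only [Int.cast_id]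
    linarith
  have hsum (H : ZMod q → ℝ) : ∑ k ∈ Finset.range q, H k = ∑ a, H a :=
    Finset.sum_nbij' (fun k => (k : ZMod q)) ZMod.val (by simp)
      (by simp [ZMod.val_lt]) (fun k hk => ZMod.val_cast_of_lt (by simpa using hk))
      (by simp) (by simp)
  have h1 : ∑ k ∈ Finset.range q, g (k * p + m)
      = ∑ a : ZMod q, G (a * p + m) := by
    rw [← hsum (fun a => G (a * p + m))]
    exact Finset.sum_congr rfl fun k _ => by rw [hG]; push_cast; rfl
  have h2 : ∑ k ∈ Finset.range q, g k = ∑ a : ZMod q, G a := by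
    rw [← hsum G]
    exact Finset.sum_congr rfl fun k _ => by rw [hG]; push_cast; rfl
  rw [h1, h2]
  let u : (ZMod q)ˣ := ZMod.unitOfCoprime p hpq
  exact Fintype.sum_equiv ((Units.mulRight u).trans (Equiv.addRight (m : ZMod q))) _ _
    (fun a => by simp [u])

theorem intervalIntegral.integral_comp_floor (g : ℤ → ℝ) (q : ℕ) :
    ∫ x in (0:ℝ)..q, g ⌊x⌋ = ∑ k ∈ Finset.range q, g k := by
  have hae (k : ℕ) : ∀ᵐ x : ℝ, x ∈ Set.uIoc (k : ℝ) ((k + 1 : ℕ) : ℝ) → g k = g ⌊x⌋ := by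
    have : ∀ᵐ x : ℝ, x ≠ ((k + 1 : ℕ) : ℝ) := by simp [ae_iff]
    filter_upwards [this] with x hx hmem
    rw [Set.uIoc_of_le (by simp)] at hmem
    congr 1
    symm
    rw [Int.floor_eq_iff]
    push_cast at hmem hx ⊢
    exact ⟨hmem.1.le, lt_of_le_of_ne hmem.2 hx⟩
  have hgint (k : ℕ) : IntervalIntegrable (fun x : ℝ => g ⌊x⌋) volume k ((k + 1 : ℕ) : ℝ) :=
    (intervalIntegrable_const (c := g k)).congr_ae
      ((ae_restrict_iff' measurableSet_uIoc).2 (hae k))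
  rw [← Nat.cast_zero, ← intervalIntegral.sum_integral_adjacent_intervals (fun k _ => hgint k)]
  refine Finset.sum_congr rfl fun k _ => ?_
  rw [← intervalIntegral.integral_congr_ae (hae k)]
  simp

theorem aestronglyMeasurable_of_ae_continuousAt {f : ℝ → ℝ}
    (hf : ∀ᵐ x, ContinuousAt f x) : AEStronglyMeasurable f volume := by
  have hm : MeasurableSet {x | ContinuousAt f x} := measurableSet_of_continuousAt f
  have h : AEStronglyMeasurable f (volume.restrict {x | ContinuousAt f x}) :=
    ContinuousOn.aestronglyMeasurable (fun x hx => ContinuousAt.continuousWithinAt hx) hm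
  rwa [Measure.restrict_eq_self_of_ae_mem (s := {x | ContinuousAt f x}) hf] at h

theorem eventually_nhdsNE_mul_ne_intCast {q : ℕ} (hq : 0 < q) (α : ℝ) :
    ∀ᶠ β : ℝ in nhdsWithin α {α}ᶜ, ∀ m : ℤ, q * β ≠ m := by
  have hq' : (q : ℝ) ≠ 0 := by positivity
  have hclosed : IsClosed ((fun m : ℤ => (m : ℝ)) '' {m | (m : ℝ) ≠ q * α}) :=
    Int.isClosedEmbedding_coe_real.isClosedMap _ (isClosed_discrete _)
  have hmem : ∀ᶠ x in nhds (q * α), x ∉ (fun m : ℤ => (m : ℝ)) '' {m | (m : ℝ) ≠ q * α} :=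
    hclosed.isOpen_compl.mem_nhds (by rintro ⟨m, hm, h⟩; exact hm h)
  have ht : Tendsto (fun β : ℝ => q * β) (nhds α) (nhds (q * α)) :=
    (continuous_const.mul continuous_id).tendsto α
  filter_upwards [nhdsWithin_le_nhds (ht.eventually hmem), self_mem_nhdsWithin] with β h hβ m hm
  refine h ⟨m, fun h' => hβ ?_, hm.symm⟩
  exact mul_left_cancel₀ hq' (hm.trans h')

theorem eventually_nhdsNE_lt_denominator (α : ℝ) (N : ℕ) :
    ∀ᶠ β : ℝ in nhdsWithin α {α}ᶜ, ∀ p q : ℕ, 0 < q → β = (p : ℝ) / q → N < q := by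
  have h : ∀ᶠ β : ℝ in nhdsWithin α {α}ᶜ, ∀ q ∈ Finset.Icc 1 N, ∀ m : ℤ, q * β ≠ m :=
    (Finset.eventually_all _).2 fun q hq =>
      eventually_nhdsNE_mul_ne_intCast (Finset.mem_Icc.1 hq).1 α
  filter_upwards [h] with β hβ p q hq hpq
  by_contra! hN
  refine hβ q (Finset.mem_Icc.2 ⟨hq, hN⟩) p ?_
  rw [hpq, mul_div_cancel₀ _ (by positivity)]
  simp

/-- The map sending `x` to the point of the coset `y + ℤ/q` associated with `⌊q x⌋`. -/
noncomputable def latticeApprox (q : ℕ) (y x : ℝ) : ℝ := (Int.fract (q * y) + ⌊q * x⌋) / q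

theorem abs_latticeApprox_sub_le {q : ℕ} (hq : 0 < q) (y x : ℝ) :
    |latticeApprox q y x - x| ≤ 1 / q := by
  have hq' : (0 : ℝ) < q := by positivity
  have : latticeApprox q y x - x = (Int.fract (q * y) - Int.fract (q * x)) / q := by
    rw [latticeApprox, Int.fract.eq_1 (q * x)]
    field_simp
    ring
  rw [this, abs_div, abs_of_pos hq']
  gcongr
  rw [abs_le]
  constructor <;> linarith [Int.fract_nonneg (q * y), Int.fract_nonneg (q * x),
    Int.fract_lt_one (q * y), Int.fract_lt_one (q * x)]

theorem average_rotation_orbit_eq_integral {h : ℝ → ℝ} (hh : Function.Periodic h 1) {p q : ℕ}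
    (hq : 0 < q) (hpq : p.Coprime q) (y : ℝ) :
    (1 / (q : ℝ)) * ∑ k ∈ Finset.range q, h (y + k * ((p : ℝ) / q))
      = ∫ x in (0:ℝ)..1, h (latticeApprox q y x) := by
  have hq' : (q : ℝ) ≠ 0 := by positivity
  let g : ℤ → ℝ := fun j => h ((Int.fract (q * y) + j) / q)
  have hg : Function.Periodic g q := fun j => by
    simp only [g]
    rw [← hh ((Int.fract (q * y) + j) / q)]
    congr 1
    push_cast
    field_simp
    ring
  have hsum : ∑ k ∈ Finset.range q, h (y + k * ((p : ℝ) / q)) = ∑ k ∈ Finset.range q, g k := by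
    rw [← hg.sum_range_mul_add hq hpq ⌊q * y⌋]
    refine Finset.sum_congr rfl fun k _ => ?_
    simp only [g]
    congr 1
    rw [Int.fract.eq_1]
    push_cast
    field_simp
    ring
  have hgint := intervalIntegral.integral_comp_mul_left (a := 0) (b := 1)
    (fun x : ℝ => g ⌊x⌋) hq'
  rw [mul_zero, mul_one, intervalIntegral.integral_comp_floor, smul_eq_mul, inv_eq_one_div]
    at hgint
  rw [hsum, ← hgint]
  rfl

theorem measurable_comp_latticeApprox (h : ℝ → ℝ) (q : ℕ) (y : ℝ) :
    Measurable fun x => h (latticeApprox q y x) :=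
  (measurable_of_countable fun j : ℤ => h ((Int.fract (q * y) + j) / q)).comp
    (Int.measurable_floor.comp (measurable_const.mul measurable_id))

/-- Dominated convergence for products of a bounded almost everywhere continuous function with
its translates, evaluated along perturbations `t i` of the identity. -/
theorem tendsto_integral_mul_translate {f : ℝ → ℝ} (hbdd : ∃ C : ℝ, ∀ x, |f x| ≤ C)
    (hf : ∀ᵐ x, ContinuousAt f x) {t : ℕ → ℝ → ℝ} {c : ℕ → ℝ} {d : ℝ}
    (hc : Tendsto c atTop (nhds d)) (ht : ∀ x, Tendsto (fun i => t i x) atTop (nhds x))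
    (hm : ∀ i, AEStronglyMeasurable (fun x => f (t i x) * f (t i x - c i)) volume) :
    Tendsto (fun i => ∫ x in (0:ℝ)..1, f (t i x) * f (t i x - c i)) atTop
      (nhds (∫ x in (0:ℝ)..1, f x * f (x - d))) := by
  obtain ⟨C, hC⟩ := hbdd
  refine intervalIntegral.tendsto_integral_filter_of_dominated_convergence (fun _ => C * C)
    (Eventually.of_forall fun i => (hm i).restrict)
    (Eventually.of_forall fun i => Eventually.of_forall fun x _ => ?_)
    intervalIntegrable_const ?_
  · rw [Real.norm_eq_abs, abs_mul]
    exact mul_le_mul (hC _) (hC _) (abs_nonneg _) ((abs_nonneg _).trans (hC x))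
  · have hd : ∀ᵐ x, ContinuousAt f (x - d) :=
      (measurePreserving_sub_right volume d).quasiMeasurePreserving.ae hf
    filter_upwards [hf, hd] with x hx hxd _
    exact (hx.tendsto.comp (ht x)).mul (hxd.tendsto.comp ((ht x).sub hc))

theorem exists_coprime_nat_div_of_not_irrational {a : ℝ} (ha : 0 < a) (h : ¬ Irrational a) :
    ∃ p q : ℕ, 0 < p ∧ 0 < q ∧ p.Coprime q ∧ a = (p : ℝ) / q := by
  obtain ⟨r, rfl⟩ := not_not.1 h
  have hr : 0 < r := by exact_mod_cast ha
  have hnum : 0 < r.num := Rat.num_pos.2 hr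
  refine ⟨r.num.natAbs, r.den, Int.natAbs_pos.2 hnum.ne', r.pos, r.reduced, ?_⟩
  rw [Nat.cast_natAbs, abs_of_pos hnum]
  exact Rat.cast_def r

/-- Convergence of the autocorrelation coefficients of the `f`-weighted return time
measures for rigid rotations with rotation numbers `α_i → α`, `α_i ≠ α`, allowing the
reference points `y_i` to vary: in both the rational and irrational case
`Ξ_i(z) → ∫₀¹ f(x) f(x − zα) dx`. -/
theorem rotation_autocorrelation_convergence_varying_points
    (f : ℝ → ℝ) (hper : Function.Periodic f 1)
    (hbdd : ∃ C : ℝ, ∀ x, |f x| ≤ C) (hnn : ∀ x, 0 ≤ f x)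
    (hdisc : volume {x : ℝ | ¬ ContinuousAt f x} = 0)
    (α : ℝ) (hαpos : 0 < α)
    (αseq : ℕ → ℝ) (hseqpos : ∀ i, 0 < αseq i)
    (hne : ∀ i, αseq i ≠ α) (hlim : Tendsto αseq atTop (nhds α))
    (y : ℕ → ℝ)
    (Ξ : ℕ → ℤ → ℝ)
    (hΞrat : ∀ i (p q : ℕ), 0 < p → 0 < q → Nat.Coprime p q → αseq i = (p : ℝ) / q →
      ∀ z : ℤ, Ξ i z = (1 / (q : ℝ)) *
        ∑ k ∈ Finset.range q,
          f (y i + (k : ℝ) * αseq i) * f (y i + ((k : ℝ) - (z : ℝ)) * αseq i))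
    (hΞirr : ∀ i, Irrational (αseq i) →
      ∀ z : ℤ, Ξ i z = ∫ x in (0:ℝ)..1, f x * f (x - (z : ℝ) * αseq i)) :
    ∀ z : ℤ,
      Tendsto (fun i => Ξ i z) atTop
        (nhds (∫ x in (0:ℝ)..1, f x * f (x - (z : ℝ) * α))) := by
  intro z
  have hf : ∀ᵐ x, ContinuousAt f x := hdisc
  have hfm := aestronglyMeasurable_of_ae_continuousAt hf
  have hα : Tendsto αseq atTop (nhdsWithin α {α}ᶜ) :=
    tendsto_nhdsWithin_iff.2 ⟨hlim, Eventually.of_forall hne⟩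
  have key : ∀ i, ∃ t : ℝ → ℝ,
      (Ξ i z = ∫ x in (0:ℝ)..1, f (t x) * f (t x - z * αseq i)) ∧
      AEStronglyMeasurable (fun x => f (t x) * f (t x - z * αseq i)) volume ∧
      ((∀ x, t x = x) ∨ ∃ p q : ℕ, 0 < q ∧ αseq i = (p : ℝ) / q ∧
        ∀ x, |t x - x| ≤ 1 / q) := by
    intro i
    by_cases hi : Irrational (αseq i)
    · exact ⟨id, hΞirr i hi z,
        hfm.mul (hfm.comp_measurePreserving (measurePreserving_sub_right volume _)),
        Or.inl fun _ => rfl⟩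
    · obtain ⟨p, q, hp, hq, hpq, hi⟩ := exists_coprime_nat_div_of_not_irrational (hseqpos i) hi
      have hh : Function.Periodic (fun x => f x * f (x - z * αseq i)) 1 :=
        hper.mul (hper.sub_const _)
      refine ⟨latticeApprox q (y i), ?_,
        (measurable_comp_latticeApprox (fun x => f x * f (x - z * αseq i)) q
          (y i)).aestronglyMeasurable,
        Or.inr ⟨p, q, hq, hi, abs_latticeApprox_sub_le hq (y i)⟩⟩
      rw [hΞrat i p q hp hq hpq hi z, ← average_rotation_orbit_eq_integral hh hq hpq, ← hi]
      congr 1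
      refine Finset.sum_congr rfl fun k _ => ?_
      ring_nf
  choose t hΞ hm ht using key
  simp only [hΞ]
  refine tendsto_integral_mul_translate hbdd hf (hlim.const_mul _) (fun x => ?_) hm
  rw [Metric.tendsto_atTop']
  intro ε hε
  obtain ⟨N, hN⟩ := exists_nat_one_div_lt hε
  obtain ⟨n, hn⟩ := eventually_atTop.1
    (hα.eventually (eventually_nhdsNE_lt_denominator α N))
  refine ⟨n, fun i hi => ?_⟩
  rcases ht i with h | ⟨p, q, hq, hpq, h⟩
  · simpa [h x] using hε
  · have hNq : (N : ℝ) + 1 ≤ q := by exact_mod_cast hn i hi.le p q hq hpq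
    rw [Real.dist_eq]
    exact (h x).trans_lt ((one_div_le_one_div_of_le (by positivity) hNq).trans_lt hN)
end
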